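/- arXiv:2304.14390 — 3 statements merged into one kernel-verified Lean document; each statement's English description precedes it below -/
import Mathlib

section
/- Let N ≥ 1, K ≥ 1, and let w̃ : Fin K → Fin N → ℝ be strictly positive incremental importance weights (w̃ k i > 0 for all k, i). Define normalized weights recursively by w₀ i = 1/N and, for k = 1, …, K, W k := ∑ j, w_{k-1} j * w̃ k j and w_k i := (w_{k-1} i * w̃ k i) / W k (each W k is strictly positive, so this is well defined). Then ∏_{k=1}^{K} W k = (1/N) * ∑ i, ∏_{k=1}^{K} w̃ k i. In other words, the product over steps of the normalized-weighted averages of the incremental weights (the objective terms of an SMC sampler without resampling) equals the simple average over particles of the products of incremental weights (the Annealed Importance Sampling estimator). -/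
open scoped BigOperators

/-- SMC-sampler objective without resampling equals the AIS estimator:
for strictly positive incremental weights `tw k i` (`k = 1, …, K`), normalized weights
defined recursively by `w 0 i = 1/N`, `W k = ∑ j, w (k-1) j * tw k j` and
`w k i = w (k-1) i * tw k i / W k`, the product of the per-step normalizers satisfies
`∏_{k=1}^K W k = (1/N) * ∑ i, ∏_{k=1}^K tw k i`. -/
theorem smc_no_resampling_eq_ais (N K : ℕ) (hN : 1 ≤ N) (hK : 1 ≤ K)
    (tw : ℕ → Fin N → ℝ) (htw : ∀ k ∈ Finset.Icc 1 K, ∀ i, 0 < tw k i)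
    (w : ℕ → Fin N → ℝ) (W : ℕ → ℝ)
    (hw0 : ∀ i, w 0 i = 1 / (N : ℝ))
    (hW : ∀ k ∈ Finset.Icc 1 K, W k = ∑ j, w (k - 1) j * tw k j)
    (hwk : ∀ k ∈ Finset.Icc 1 K, ∀ i, w k i = w (k - 1) i * tw k i / W k) :
    ∏ k ∈ Finset.Icc 1 K, W k = (1 / (N : ℝ)) * ∑ i, ∏ k ∈ Finset.Icc 1 K, tw k i := by
  have : Nonempty (Fin N) := ⟨⟨0, hN⟩⟩
  have hN' : (0 : ℝ) < N := by exact_mod_cast hN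
  -- The unnormalized weight of particle `i` after `n` steps is `(1/N) ∏ k ≤ n, tw k i`.
  have key : ∀ n ≤ K, ∀ i, 0 < w n i ∧
      w n i * ∏ k ∈ Finset.Icc 1 n, W k = 1 / (N : ℝ) * ∏ k ∈ Finset.Icc 1 n, tw k i := by
    intro n
    induction n with
    | zero =>
      intro _ i
      simp [hw0, hN']
    | succ n ih =>
      intro hn i
      have hmem : n + 1 ∈ Finset.Icc 1 K := Finset.mem_Icc.2 ⟨by omega, hn⟩
      have ih := ih (by omega)
      have hpos : 0 < W (n + 1) := by
        rw [hW _ hmem]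
        exact Finset.sum_pos (fun j _ => mul_pos (ih j).1 (htw _ hmem j)) Finset.univ_nonempty
      have hw : w (n + 1) i = w n i * tw (n + 1) i / W (n + 1) := hwk _ hmem i
      refine ⟨hw ▸ div_pos (mul_pos (ih i).1 (htw _ hmem i)) hpos, ?_⟩
      rw [Finset.prod_Icc_succ_top (by omega), Finset.prod_Icc_succ_top (by omega), hw,
        ← mul_assoc (1 / (N : ℝ)), ← (ih i).2]
      field_simp
  obtain ⟨n, rfl⟩ : ∃ n, K = n + 1 := ⟨K - 1, by omega⟩
  have hWn : W (n + 1) = ∑ j, w n j * tw (n + 1) j :=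
    hW _ (Finset.mem_Icc.2 ⟨hK, le_rfl⟩)
  rw [Finset.prod_Icc_succ_top (by omega), hWn, Finset.mul_sum, Finset.mul_sum]
  refine Finset.sum_congr rfl fun i _ => ?_
  rw [Finset.prod_Icc_succ_top (by omega), ← mul_assoc (1 / (N : ℝ)),
    ← (key n (by omega) i).2]
  ring
end

section
/- Let E be a type, K ≥ 1, N ≥ 1, let π₀ be a probability mass function on E and let F_k : E → PMF E (k = 1, …, K) be Markov transition kernels. Fix deterministic index maps ι_k : Fin N → Fin N for k = 0, …, K−1, and let the branching particle process be defined as follows: z₀ = (z₀¹, …, z₀ᴺ) has independent coordinates each distributed according to π₀, and for k = 1, …, K, conditionally on the past the coordinates z_kⁱ are independent with z_kⁱ distributed according to F_k(z_{k-1}^{ι_{k-1}(i)}). Fix j_K ∈ Fin N and define the ancestral indices recursively by j_{k-1} := ι_{k-1}(j_k). Then the joint law of the ancestral trajectory (z₀^{j₀}, z₁^{j₁}, …, z_K^{j_K}) equals the law of the single Markov chain (x₀, x₁, …, x_K) with x₀ ∼ π₀ and x_k ∼ F_k(x_{k-1}). (This is the marginalization step in the proof of Theorem 1: the ancestral line of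 a branching particle system with fixed resampling maps is a single, non-branching Markov chain.) -/
open scoped BigOperators

/-- Law of a vector of independent coordinates, coordinate `i` distributed as `μ i`. -/
noncomputable def indepMap {E : Type*} : (n : ℕ) → (Fin n → PMF E) → PMF (Fin n → E)
  | 0, _ => PMF.pure fun i => i.elim0
  | n + 1, μ =>
      (indepMap n fun i => μ i.castSucc).bind fun f =>
        (μ (Fin.last n)).map fun x => Fin.snoc f x

/-- Law of the single Markov chain `x₀ ∼ π`, `x_k ∼ F k (x_{k-1})` for `k = 1, …, K`. -/
noncomputable def chainLaw {E : Type*} (π : PMF E) (F : ℕ → E → PMF E) :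
    (K : ℕ) → PMF (Fin (K + 1) → E)
  | 0 => π.map fun x _ => x
  | K + 1 =>
      (chainLaw π F K).bind fun traj =>
        (F (K + 1) (traj (Fin.last K))).map fun x => Fin.snoc traj x

/-- Law of the branching particle system with `N` particles: `z₀` has i.i.d. coordinates
drawn from `π`, and given the past, the coordinates `z_k i` are independent with
`z_k i ∼ F k (z_{k-1} (ι (k-1) i))`, for fixed deterministic resampling maps `ι`. -/
noncomputable def branchLaw {E : Type*} (N : ℕ) (π : PMF E) (F : ℕ → E → PMF E)
    (ι : ℕ → Fin N → Fin N) : (K : ℕ) → PMF (Fin (K + 1) → Fin N → E)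
  | 0 => (indepMap N fun _ => π).map fun z _ => z
  | K + 1 =>
      (branchLaw N π F ι K).bind fun traj =>
        (indepMap N fun i => F (K + 1) (traj (Fin.last K) (ι K (i)))).map fun z =>
          Fin.snoc traj z

/-- Ancestral indices traced back from the distinguished final index `jK` at time `K`:
`ancestor ι K jK m` is the index of the ancestral particle at time `K - m`, i.e.
`ancestor _ _ _ 0 = jK` and `j_{k-1} = ι_{k-1} (j_k)`. -/
def ancestor {N : ℕ} (ι : ℕ → Fin N → Fin N) (K : ℕ) (jK : Fin N) : ℕ → Fin N
  | 0 => jK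
  | m + 1 => ι (K - (m + 1)) (ancestor ι K jK m)

/-- Each coordinate of an independent vector has its prescribed marginal law. -/
theorem indepMap_map_apply {E : Type*} (n : ℕ) (μ : Fin n → PMF E) (i : Fin n) :
    (indepMap n μ).map (fun f => f i) = μ i := by
  induction n with
  | zero => exact i.elim0
  | succ n ih =>
    rw [indepMap, PMF.map_bind]
    simp only [PMF.map_comp, Function.comp_def]
    induction i using Fin.lastCases with
    | last =>
      simp only [Fin.snoc_last, PMF.bind_const]
      exact PMF.map_id _
    | cast i =>
      simp only [Fin.snoc_castSucc]
      refine Eq.trans ?_ (ih (fun i => μ i.castSucc) i)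
      exact congrArg _ (funext fun f => PMF.map_const _ (f i))

/-- Tracing `m + 1` steps back from time `K + 1` is tracing `m` steps back from the parent. -/
theorem ancestor_succ_succ {N : ℕ} (ι : ℕ → Fin N → Fin N) (K : ℕ) (j : Fin N) (m : ℕ) :
    ancestor ι (K + 1) j (m + 1) = ancestor ι K (ι K j) m := by
  induction m with
  | zero => simp [ancestor]
  | succ m ih => rw [ancestor, ih, ancestor, Nat.add_sub_add_right]

theorem branchLaw_map_ancestor {E : Type*} (K N : ℕ) (π : PMF E) (F : ℕ → E → PMF E)
    (ι : ℕ → Fin N → Fin N) (j : Fin N) :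
    (branchLaw N π F ι K).map
        (fun traj => fun k : Fin (K + 1) => traj k (ancestor ι K j (K - (k : ℕ)))) =
      chainLaw π F K := by
  induction K generalizing j with
  | zero =>
    have marginal := congrArg (PMF.map fun (x : E) (_ : Fin 1) => x)
      (indepMap_map_apply N (fun _ => π) j)
    rw [PMF.map_comp] at marginal
    rw [branchLaw, chainLaw, ← marginal, PMF.map_comp]
    simp [Function.comp_def, ancestor]
  | succ K ih =>
    have snoc_ancestor (traj : Fin (K + 1) → Fin N → E) (z : Fin N → E) :
        (fun k : Fin (K + 2) => (Fin.snoc traj z : Fin (K + 2) → Fin N → E) k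
          (ancestor ι (K + 1) j (K + 1 - (k : ℕ)))) =
        (Fin.snoc (fun k : Fin (K + 1) => traj k (ancestor ι K (ι K j) (K - (k : ℕ)))) (z j) :
          Fin (K + 2) → E) := by
      funext k
      induction k using Fin.lastCases with
      | last => simp [ancestor]
      | cast k =>
        simp only [Fin.snoc_castSucc, Fin.val_castSucc]
        rw [Nat.succ_sub k.is_le, ancestor_succ_succ]
    rw [branchLaw, chainLaw, ← ih (ι K j), PMF.map_bind, PMF.bind_map]
    congr 1
    funext traj
    simp only [PMF.map_comp, Function.comp_def, Fin.val_last, Nat.sub_self, ancestor]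
    rw [← indepMap_map_apply N (fun i => F (K + 1) (traj (Fin.last K) (ι K i))) j, PMF.map_comp]
    exact congrArg (PMF.map · _) (funext fun z => snoc_ancestor traj z)

/-- The ancestral trajectory of a branching particle system with fixed resampling maps is a
single, non-branching Markov chain: the pushforward of the branching law under
`traj ↦ (k ↦ traj k (j_k))`, where `j_K = jK` and `j_{k-1} = ι_{k-1}(j_k)`, equals the law
of the Markov chain `x₀ ∼ π`, `x_k ∼ F k (x_{k-1})`. -/
theorem ancestral_trajectory_is_markov_chain {E : Type*} (K N : ℕ) (hK : 1 ≤ K) (hN : 1 ≤ N)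
    (π : PMF E) (F : ℕ → E → PMF E) (ι : ℕ → Fin N → Fin N) (jK : Fin N) :
    (branchLaw N π F ι K).map
        (fun traj => fun k : Fin (K + 1) => traj k (ancestor ι K jK (K - (k : ℕ)))) =
      chainLaw π F K := by
  exact branchLaw_map_ancestor K N π F ι jK
end

section
/- Let E be a finite nonempty type and K ≥ 1. Let γ : Fin (K+1) → E → ℝ be strictly positive unnormalized densities with γ 0 normalized, i.e. γ k x > 0 for all k, x and ∑ x, γ 0 x = 1. Let F_k : E → E → ℝ (k = 1, …, K) be forward transition kernels with F_k x y > 0 and ∑ y, F_k x y = 1 for all x, and let B_k : E → E → ℝ (k = 1, …, K) be backward transition kernels with B_k x y ≥ 0 and ∑ y, B_k x y = 1 for all x. Then the importance-weighted path sum satisfies ∑_{z : Fin (K+1) → E} γ 0 (z 0) · (∏_{k=1}^{K} F_k (z (k-1)) (z k)) · ∏_{k=1}^{K} [ γ k (z k) · B_k (z k) (z (k-1)) ] / [ γ (k-1) (z (k-1)) · F_k (z (k-1)) (z k) ] = ∑_x γ K x. That is, the expectation under the forward path distribution of the product of incremental importance weights w̃_k(z_k, z_{k-1}) := γ_k(z_k)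 B_k(z_{k-1} | z_k) / (γ_{k-1}(z_{k-1}) F_k(z_k | z_{k-1})) equals the normalization constant Z = ∑_x γ K x of the final unnormalized density. -/
open scoped BigOperators

/-- Summing a function of the endpoint of a path against backward transition kernels
integrates out all the earlier states. -/
theorem sum_path_mul_prod_backward {E R : Type*} [Fintype E] [CommSemiring R] (n : ℕ)
    (g : E → R) (B : Fin n → E → E → R) (hB : ∀ k x, ∑ y, B k x y = 1) :
    ∑ z : Fin (n + 1) → E, g (z (Fin.last n)) * ∏ k : Fin n, B k (z k.succ) (z k.castSucc) =
      ∑ x, g x := by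
  induction n with
  | zero => simpa using (Equiv.funUnique (Fin 1) E).sum_comp g
  | succ n ih =>
    rw [← ih (fun k => B k.succ) fun k => hB k.succ,
      ← (Fin.consEquiv fun _ : Fin (n + 2) => E).sum_comp, Fintype.sum_prod_type_right]
    refine Finset.sum_congr rfl fun z _ => ?_
    simp only [Fin.consEquiv_apply, Fin.prod_univ_succ, ← Fin.succ_last, Fin.cons_succ,
      Fin.castSucc_zero, Fin.cons_zero, ← Fin.succ_castSucc]
    rw [← Finset.mul_sum, ← Finset.sum_mul, hB, one_mul]

theorem Fin.mul_prod_succ_div_castSucc {G : Type*} [CommGroupWithZero G] {n : ℕ}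
    (a : Fin (n + 1) → G) (ha : ∀ k, a k ≠ 0) :
    a 0 * ∏ k : Fin n, a k.succ / a k.castSucc = a (Fin.last n) := by
  rw [Finset.prod_div_distrib, ← mul_div_assoc, ← Fin.prod_univ_succ, Fin.prod_univ_castSucc,
    mul_div_cancel_left₀ _ (Finset.prod_ne_zero_iff.2 fun k _ => ha _)]

/-- Unbiasedness of the SMC-sampler importance weights: for strictly positive unnormalized
densities `γ 0, …, γ K` with `γ 0` normalized, strictly positive row-stochastic forward
kernels `F k` and nonnegative row-stochastic backward kernels `B k` (`k = 1, …, K`), the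
expectation under the forward path distribution of the product of incremental importance
weights `w̃_k(z_k, z_{k-1}) = γ_k(z_k) B_k(z_{k-1} | z_k) / (γ_{k-1}(z_{k-1}) F_k(z_k | z_{k-1}))`
equals the normalization constant `Z = ∑ x, γ K x` of the final unnormalized density. -/
theorem smc_weights_unbiased {E : Type*} [Fintype E] [Nonempty E] (K : ℕ) (hK : 1 ≤ K)
    (γ : Fin (K + 1) → E → ℝ) (hγ : ∀ k x, 0 < γ k x) (hγ0 : ∑ x, γ 0 x = 1)
    (F : ℕ → E → E → ℝ) (hFpos : ∀ k ∈ Finset.Icc 1 K, ∀ x y, 0 < F k x y)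
    (hFsum : ∀ k ∈ Finset.Icc 1 K, ∀ x, ∑ y, F k x y = 1)
    (B : ℕ → E → E → ℝ) (hBpos : ∀ k ∈ Finset.Icc 1 K, ∀ x y, 0 ≤ B k x y)
    (hBsum : ∀ k ∈ Finset.Icc 1 K, ∀ x, ∑ y, B k x y = 1) :
    ∑ z : Fin (K + 1) → E,
        (γ 0 (z 0) * ∏ k : Fin K, F ((k : ℕ) + 1) (z k.castSucc) (z k.succ)) *
          ∏ k : Fin K,
            γ k.succ (z k.succ) * B ((k : ℕ) + 1) (z k.succ) (z k.castSucc) /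
              (γ k.castSucc (z k.castSucc) * F ((k : ℕ) + 1) (z k.castSucc) (z k.succ)) =
      ∑ x, γ (Fin.last K) x := by
  rw [← sum_path_mul_prod_backward K (γ (Fin.last K)) (fun k => B (k + 1))
    fun k => hBsum _ (Finset.mem_Icc.2 ⟨by lia, by lia⟩)]
  refine Finset.sum_congr rfl fun z _ => ?_
  rw [← Fin.mul_prod_succ_div_castSucc (fun k => γ k (z k)) fun k => (hγ k _).ne', mul_assoc,
    mul_assoc, ← Finset.prod_mul_distrib, ← Finset.prod_mul_distrib]
  congr 1
  refine Finset.prod_congr rfl fun k _ => ?_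
  have hF := (hFpos (k + 1) (Finset.mem_Icc.2 ⟨by lia, by lia⟩) (z k.castSucc) (z k.succ)).ne'
  have hγk := (hγ k.castSucc (z k.castSucc)).ne'
  field_simp
end
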